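/- Let g ∈ S₀(ℝ), let α, β > 0 be such that (g, αℤ×βℤ) is a frame sequence with canonical dual window γ, and let ν ∈ ℕ, ν ≥ 1. Let 𝒦 be the closed linear span of {T_{k/β} M_{ℓ/α} g : k, ℓ ∈ ℤ} and, for s = 0, …, ν−1, let ℒ_s be the closed linear span of {T_{k/β} M_{(ℓν+s)/α} g : k, ℓ ∈ ℤ}. If for every s = 0, …, ν−1 one has (αβ)^{−1} ∑_{k,ℓ∈ℤ} ⟨M_{s/α} g, T_{k/β} M_{ℓν/α} γ⟩ T_{k/β} M_{ℓν/α} g = g for s = 0 and = 0 for s ≠ 0 (the sums converging unconditionally in L²), then 𝒦 is the direct sum ℒ_0 ∔ ⋯ ∔ ℒ_{ν−1}; that is, 𝒦 = ℒ_0 + ⋯ + ℒ_{ν−1} and ℒ_i ∩ (∑_{j ≠ i} ℒ_j) = {0} for every i = 0, …, ν−1. -/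

import Mathlib

open MeasureTheory Complex Filter
open scoped ENNReal InnerProductSpace RealInnerProductSpace ComplexConjugate

noncomputable section

/-- The Hilbert space `L²(ℝ)` of complex-valued square-integrable functions. -/
abbrev L2 : Type := Lp ℂ 2 (volume : Measure ℝ)

lemma memLp_translate (a : ℝ) (f : L2) :
    MemLp (fun x : ℝ => f (x - a)) 2 (volume : Measure ℝ) :=
  (Lp.memLp f).comp_measurePreserving (measurePreserving_sub_right volume a)

lemma memLp_modulate (b : ℝ) (f : L2) :
    MemLp (fun x : ℝ => Complex.exp (2 * Real.pi * Complex.I * (b * x)) * f x) 2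
      (volume : Measure ℝ) := by
  refine MemLp.of_le (Lp.memLp f) ?_ ?_
  · exact (Complex.continuous_exp.comp (by fun_prop)).aestronglyMeasurable.mul
      (Lp.aestronglyMeasurable f)
  · filter_upwards with x
    have : Complex.exp (2 * Real.pi * Complex.I * (b * x))
        = Complex.exp ((2 * Real.pi * (b * x) : ℝ) * Complex.I) := by
      push_cast; ring_nf
    rw [norm_mul, this, Complex.norm_exp_ofReal_mul_I, one_mul]

/-- Translation `T_a` on `L²(ℝ)`: `(T_a f)(x) = f (x - a)`. -/
def Tr (a : ℝ) (f : L2) : L2 := (memLp_translate a f).toLp _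

/-- Modulation `M_b` on `L²(ℝ)`: `(M_b f)(x) = e^{2πibx} f x`. -/
def Mo (b : ℝ) (f : L2) : L2 := (memLp_modulate b f).toLp _

/-- Time-frequency shift `π(a,b) = T_a M_b`. -/
def tf (z : ℝ × ℝ) (f : L2) : L2 := Tr z.1 (Mo z.2 f)

/-- The closed linear span `𝒢(g,Λ)` of the Gabor system `(g,Λ)`. -/
def gaborSpan (g : L2) (Λ : Set (ℝ × ℝ)) : Set L2 :=
  closure (Submodule.span ℂ ((fun z => tf z g) '' Λ) : Set L2)

/-- `𝔍(𝒢)`: the set of time-frequency shifts leaving `𝒢` invariant. -/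
def stab (G : Set L2) : Set (ℝ × ℝ) := {z | ∀ f ∈ G, tf z f ∈ G}

/-- `Λ` is a lattice in `ℝ²` if `Λ = Aℤ²` for an invertible `2×2` matrix `A`. -/
def IsLattice (Λ : Set (ℝ × ℝ)) : Prop :=
  ∃ A : Matrix (Fin 2) (Fin 2) ℝ, IsUnit A.det ∧
    Λ = {p : ℝ × ℝ | ∃ k l : ℤ,
      p = (A 0 0 * k + A 0 1 * l, A 1 0 * k + A 1 1 * l)}

lemma memLp_gaussian : MemLp (fun x : ℝ => (Real.exp (-Real.pi * x ^ 2) : ℂ)) 2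
    (volume : Measure ℝ) := by
  rw [memLp_two_iff_integrable_sq_norm]
  · have h : Integrable (fun x : ℝ => Real.exp (-(2 * Real.pi) * x ^ 2)) volume :=
      integrable_exp_neg_mul_sq (by positivity)
    refine h.congr (Eventually.of_forall fun x => ?_)
    simp only [Complex.norm_real, Real.norm_eq_abs, Real.abs_exp, sq, ← Real.exp_add]
    ring_nf
  · exact (Complex.continuous_ofReal.comp (by fun_prop)).aestronglyMeasurable

/-- The Gaussian `φ(x) = e^{-πx²}` as an element of `L²(ℝ)`. -/
def gaussL2 : L2 := memLp_gaussian.toLp _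

/-- The Feichtinger algebra condition: `f ∈ S₀(ℝ)` iff `(a,b) ↦ ⟨f, π(a,b)φ⟩ ∈ L¹(ℝ²)`. -/
def InS0 (f : L2) : Prop :=
  Integrable (fun z : ℝ × ℝ => ⟪tf z gaussL2, f⟫_ℂ) (volume : Measure (ℝ × ℝ))

/-- `(g,Λ)` is a frame for its closed linear span. -/
def IsFrameSeq (g : L2) (Λ : Set (ℝ × ℝ)) : Prop :=
  ∃ A B : ℝ, 0 < A ∧ 0 < B ∧ ∀ f ∈ gaborSpan g Λ,
    A * ‖f‖ ^ 2 ≤ ∑' lam : Λ, ‖⟪tf (lam : ℝ × ℝ) g, f⟫_ℂ‖ ^ 2 ∧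
    ∑' lam : Λ, ‖⟪tf (lam : ℝ × ℝ) g, f⟫_ℂ‖ ^ 2 ≤ B * ‖f‖ ^ 2

/-- `(g,Λ)` is a frame for all of `L²(ℝ)`. -/
def IsFrameL2 (g : L2) (Λ : Set (ℝ × ℝ)) : Prop :=
  ∃ A B : ℝ, 0 < A ∧ 0 < B ∧ ∀ f : L2,
    A * ‖f‖ ^ 2 ≤ ∑' lam : Λ, ‖⟪tf (lam : ℝ × ℝ) g, f⟫_ℂ‖ ^ 2 ∧
    ∑' lam : Λ, ‖⟪tf (lam : ℝ × ℝ) g, f⟫_ℂ‖ ^ 2 ≤ B * ‖f‖ ^ 2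

/-- Euclidean ball of radius `ε` around `a ∈ ℝ²`. -/
def eball (ε : ℝ) (a : ℝ × ℝ) : Set (ℝ × ℝ) :=
  {x : ℝ × ℝ | Real.sqrt ((x.1 - a.1) ^ 2 + (x.2 - a.2) ^ 2) < ε}

/-- `B_ε(Δ) = ⋃_{a ∈ Δ} B_ε(a)`. -/
def eballSet (ε : ℝ) (Δ : Set (ℝ × ℝ)) : Set (ℝ × ℝ) := ⋃ a ∈ Δ, eball ε a

/-- The separable lattice `αℤ × βℤ`. -/
def sepLattice (α β : ℝ) : Set (ℝ × ℝ) :=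
  {p : ℝ × ℝ | ∃ k l : ℤ, p = (α * k, β * l)}


/-- `γ` is the canonical dual window of the frame sequence `(g, αℤ×βℤ)`:
`γ` belongs to `𝒢(g, αℤ×βℤ)` and `Sγ = g` for the frame operator `S`,
the defining series converging unconditionally in `L²`. -/
def IsDualWindow (g γ : L2) (α β : ℝ) : Prop :=
  γ ∈ gaborSpan g (sepLattice α β) ∧
  HasSum (fun lam : sepLattice α β =>
    ⟪tf (lam : ℝ × ℝ) g, γ⟫_ℂ • tf (lam : ℝ × ℝ) g) g

/-- The closed linear span `𝒦` of the adjoint system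
`{T_{k/β} M_{ℓ/α} g : k, ℓ ∈ ℤ}`, as a (closed) subspace. -/
def Ksub (g : L2) (α β : ℝ) : Submodule ℂ L2 :=
  (Submodule.span ℂ
    {f : L2 | ∃ k l : ℤ, f = tf ((k : ℝ) / β, (l : ℝ) / α) g}).topologicalClosure

/-- The closed linear span `ℒ_s` of `{T_{k/β} M_{(ℓν+s)/α} g : k, ℓ ∈ ℤ}`. -/
def Lsub (g : L2) (α β : ℝ) (ν s : ℕ) : Submodule ℂ L2 :=
  (Submodule.span ℂ
    {f : L2 | ∃ k l : ℤ,
      f = tf ((k : ℝ) / β, ((l : ℝ) * (ν : ℝ) + (s : ℝ)) / α) g}).topologicalClosure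


section BesselFamilies

variable {ι H : Type*} [NormedAddCommGroup H] [InnerProductSpace ℂ H]

/-- The family `u` satisfies the synthesis form of the Bessel condition with bound `B`. -/
def IsBessel (u : ι → H) (B : ℝ) : Prop :=
  0 ≤ B ∧ ∀ (F : Finset ι) (c : ι → ℂ), ‖∑ i ∈ F, c i • u i‖ ^ 2 ≤ B * ∑ i ∈ F, ‖c i‖ ^ 2

lemma inner_sum_inner_smul (u : ι → H) (F : Finset ι) (f : H) :
    ⟪∑ i ∈ F, ⟪u i, f⟫_ℂ • u i, f⟫_ℂ = ((∑ i ∈ F, ‖⟪u i, f⟫_ℂ‖ ^ 2 : ℝ) : ℂ) := by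
  rw [sum_inner, ofReal_sum]
  refine Finset.sum_congr rfl fun i _ => ?_
  rw [inner_smul_left, Complex.conj_mul', ofReal_pow]

lemma IsBessel.sum_sq_norm_inner_le {u : ι → H} {B : ℝ} (hu : IsBessel u B) (F : Finset ι)
    (f : H) : ∑ i ∈ F, ‖⟪u i, f⟫_ℂ‖ ^ 2 ≤ B * ‖f‖ ^ 2 := by
  obtain ⟨hB, hu⟩ := hu
  set t := ∑ i ∈ F, ‖⟪u i, f⟫_ℂ‖ ^ 2 with ht
  have ht0 : 0 ≤ t := Finset.sum_nonneg fun i _ => by positivity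
  set x := ∑ i ∈ F, ⟪u i, f⟫_ℂ • u i
  have h1 : t ≤ ‖x‖ * ‖f‖ := by
    have h := norm_inner_le_norm (𝕜 := ℂ) x f
    rwa [inner_sum_inner_smul, Complex.norm_real, Real.norm_of_nonneg ht0] at h
  have h2 : ‖x‖ ^ 2 ≤ B * t := hu F _
  rcases ht0.eq_or_lt with h0 | h0
  · rw [← h0]; positivity
  · have h3 : t ^ 2 ≤ (‖x‖ * ‖f‖) ^ 2 := pow_le_pow_left₀ ht0 h1 2
    rw [mul_pow] at h3
    have h4 : t * t ≤ (B * ‖f‖ ^ 2) * t := by nlinarith [sq_nonneg ‖f‖]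
    exact le_of_mul_le_mul_right h4 h0

lemma IsBessel.of_sum_sq_norm_inner_le {u : ι → H} {B : ℝ} (hB : 0 ≤ B)
    (hu : ∀ (F : Finset ι) (f : H), ∑ i ∈ F, ‖⟪u i, f⟫_ℂ‖ ^ 2 ≤ B * ‖f‖ ^ 2) :
    IsBessel u B := by
  refine ⟨hB, fun F c => ?_⟩
  set x := ∑ i ∈ F, c i • u i with hx
  have h1 : ‖x‖ ^ 2 ≤ ∑ i ∈ F, ‖c i‖ * ‖⟪u i, x⟫_ℂ‖ := by
    have h : ((‖x‖ ^ 2 : ℝ) : ℂ) = ∑ i ∈ F, conj (c i) * ⟪u i, x⟫_ℂ := by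
      rw [ofReal_pow]
      refine (inner_self_eq_norm_sq_to_K (𝕜 := ℂ) x).symm.trans ?_
      conv_lhs => rw [hx, sum_inner]
      simp only [inner_smul_left, ← hx]
    calc ‖x‖ ^ 2 = ‖((‖x‖ ^ 2 : ℝ) : ℂ)‖ := by
          rw [Complex.norm_real, Real.norm_of_nonneg (by positivity)]
      _ ≤ ∑ i ∈ F, ‖conj (c i) * ⟪u i, x⟫_ℂ‖ := by rw [h]; exact norm_sum_le _ _
      _ = _ := by simp
  have h2 : (∑ i ∈ F, ‖c i‖ * ‖⟪u i, x⟫_ℂ‖) ^ 2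
      ≤ (∑ i ∈ F, ‖c i‖ ^ 2) * ∑ i ∈ F, ‖⟪u i, x⟫_ℂ‖ ^ 2 :=
    Finset.sum_mul_sq_le_sq_mul_sq _ _ _
  have hc : 0 ≤ ∑ i ∈ F, ‖c i‖ ^ 2 := Finset.sum_nonneg fun i _ => by positivity
  have h3 : (‖x‖ ^ 2) ^ 2 ≤ (∑ i ∈ F, ‖c i‖ ^ 2) * (B * ‖x‖ ^ 2) :=
    (pow_le_pow_left₀ (by positivity) h1 2).trans
      (h2.trans (mul_le_mul_of_nonneg_left (hu F x) hc))
  rcases (sq_nonneg ‖x‖).eq_or_lt with h0 | h0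
  · rw [← h0]; positivity
  · refine le_of_mul_le_mul_right ?_ h0
    nlinarith

lemma IsBessel.comp_injective {κ : Type*} {u : ι → H} {B : ℝ} (hu : IsBessel u B) {e : κ → ι}
    (he : Function.Injective e) : IsBessel (u ∘ e) B := by
  refine .of_sum_sq_norm_inner_le hu.1 fun F f => ?_
  simpa using hu.sum_sq_norm_inner_le (F.map ⟨e, he⟩) f

lemma IsBessel.summable_sq_norm_inner {u : ι → H} {B : ℝ} (hu : IsBessel u B) (f : H) :
    Summable fun i => ‖⟪u i, f⟫_ℂ‖ ^ 2 :=
  summable_of_sum_le (fun _ => by positivity) (hu.sum_sq_norm_inner_le · f)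

lemma IsBessel.summable_smul [CompleteSpace H] {u : ι → H} {B : ℝ} (hu : IsBessel u B)
    {c : ι → ℂ} (hc : Summable fun i => ‖c i‖ ^ 2) : Summable fun i => c i • u i := by
  rw [summable_iff_vanishing_norm]
  intro ε hε
  obtain ⟨s, hs⟩ := (summable_iff_vanishing_norm.mp hc) (ε ^ 2 / (B + 1))
    (div_pos (by positivity) (by linarith [hu.1]))
  refine ⟨s, fun t ht => ?_⟩
  have h1 := hs t ht
  rw [Real.norm_of_nonneg (Finset.sum_nonneg fun i _ => by positivity),
    lt_div_iff₀ (by linarith [hu.1])] at h1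
  have h2 := hu.2 t c
  have h3 : 0 ≤ ∑ i ∈ t, ‖c i‖ ^ 2 := Finset.sum_nonneg fun i _ => by positivity
  exact lt_of_pow_lt_pow_left₀ 2 hε.le (by nlinarith)

/-- The mixed frame operator `f ↦ ∑ ⟨v i, f⟩ u i` of two Bessel families is bounded. -/
lemma IsBessel.exists_mixed_frame_operator [CompleteSpace H] {u v : ι → H} {B C : ℝ}
    (hu : IsBessel u B) (hv : IsBessel v C) :
    ∃ P : H →L[ℂ] H, ∀ f, HasSum (fun i => ⟪v i, f⟫_ℂ • u i) (P f) := by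
  have hs (f : H) : HasSum (fun i => ⟪v i, f⟫_ℂ • u i) (∑' i, ⟪v i, f⟫_ℂ • u i) :=
    (hu.summable_smul (hv.summable_sq_norm_inner f)).hasSum
  let P₀ : H →ₗ[ℂ] H :=
    { toFun := fun f => ∑' i, ⟪v i, f⟫_ℂ • u i
      map_add' := fun f₁ f₂ => by
        refine HasSum.tsum_eq ?_
        simpa only [inner_add_right, add_smul] using (hs f₁).add (hs f₂)
      map_smul' := fun a f => by
        refine HasSum.tsum_eq ?_
        simpa only [inner_smul_right, mul_smul, RingHom.id_apply] using (hs f).const_smul a }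
  refine ⟨P₀.mkContinuous (Real.sqrt (B * C)) fun f => ?_, hs⟩
  refine le_of_tendsto (hs f).norm (Eventually.of_forall fun F => ?_)
  refine le_of_sq_le_sq ?_ (by positivity)
  rw [mul_pow, Real.sq_sqrt (mul_nonneg hu.1 hv.1), mul_assoc]
  exact (hu.2 F _).trans (mul_le_mul_of_nonneg_left (hv.sum_sq_norm_inner_le F f) hu.1)

end BesselFamilies

section TimeFrequencyShifts

/-- The character `t ↦ e^{2πit}`. -/
def expTwoPi (t : ℝ) : ℂ := Complex.exp (2 * Real.pi * Complex.I * t)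

lemma expTwoPi_add (s t : ℝ) : expTwoPi (s + t) = expTwoPi s * expTwoPi t := by
  rw [expTwoPi, expTwoPi, expTwoPi, ← Complex.exp_add]; push_cast; ring_nf

@[simp] lemma expTwoPi_zero : expTwoPi 0 = 1 := by simp [expTwoPi]

lemma expTwoPi_intCast (n : ℤ) : expTwoPi n = 1 :=
  Complex.exp_eq_one_iff.mpr ⟨n, by push_cast; ring⟩

@[simp] lemma norm_expTwoPi (t : ℝ) : ‖expTwoPi t‖ = 1 := by
  have : expTwoPi t = Complex.exp ((2 * Real.pi * t : ℝ) * Complex.I) := by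
    rw [expTwoPi]; push_cast; ring_nf
  rw [this, Complex.norm_exp_ofReal_mul_I]

lemma expTwoPi_ne_zero (t : ℝ) : expTwoPi t ≠ 0 := Complex.exp_ne_zero _

lemma conj_expTwoPi_mul_self (t : ℝ) : conj (expTwoPi t) * expTwoPi t = 1 := by
  rw [Complex.conj_mul', norm_expTwoPi]; simp

lemma conj_expTwoPi (t : ℝ) : conj (expTwoPi t) = expTwoPi (-t) := by
  have h : expTwoPi (-t) * expTwoPi t = 1 := by rw [← expTwoPi_add]; simp
  exact mul_right_cancel₀ (expTwoPi_ne_zero t) ((conj_expTwoPi_mul_self t).trans h.symm)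

@[fun_prop]
lemma continuous_expTwoPi : Continuous expTwoPi := by
  unfold expTwoPi; fun_prop

lemma coeFn_Tr (a : ℝ) (f : L2) : Tr a f =ᵐ[volume] fun x => f (x - a) :=
  (memLp_translate a f).coeFn_toLp

lemma coeFn_Mo (b : ℝ) (f : L2) : Mo b f =ᵐ[volume] fun x => expTwoPi (b * x) * f x := by
  filter_upwards [(memLp_modulate b f).coeFn_toLp] with x hx
  rw [Mo, hx, expTwoPi]; push_cast; rfl

lemma ae_sub {p : ℝ → Prop} (h : ∀ᵐ x ∂(volume : Measure ℝ), p x) (a : ℝ) :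
    ∀ᵐ x ∂(volume : Measure ℝ), p (x - a) :=
  (measurePreserving_sub_right volume a).quasiMeasurePreserving.ae h

lemma coeFn_tf (z : ℝ × ℝ) (f : L2) :
    tf z f =ᵐ[volume] fun x => expTwoPi (z.2 * (x - z.1)) * f (x - z.1) := by
  filter_upwards [coeFn_Tr z.1 (Mo z.2 f), ae_sub (coeFn_Mo z.2 f) z.1] with x h1 h2
  rw [tf, h1, h2]

/-- The time-frequency shift `tf z` as a linear isometry. -/
def tfIsometry (z : ℝ × ℝ) : L2 →ₗᵢ[ℂ] L2 where
  toFun := tf z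
  map_add' f h := by
    refine Lp.ext ?_
    filter_upwards [coeFn_tf z (f + h), ae_sub (Lp.coeFn_add f h) z.1,
      Lp.coeFn_add (tf z f) (tf z h), coeFn_tf z f, coeFn_tf z h] with x h1 h2 h3 h4 h5
    rw [h1, h3, Pi.add_apply, h4, h5, h2, Pi.add_apply, mul_add]
  map_smul' c f := by
    refine Lp.ext ?_
    filter_upwards [coeFn_tf z (c • f), ae_sub (Lp.coeFn_smul c f) z.1,
      Lp.coeFn_smul c (tf z f), coeFn_tf z f] with x h1 h2 h3 h4
    rw [h1, RingHom.id_apply, h3, Pi.smul_apply, h4, h2, Pi.smul_apply, smul_eq_mul, smul_eq_mul]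
    ring
  norm_map' f := by
    change ‖tf z f‖ = ‖f‖
    have h1 : eLpNorm (tf z f) 2 volume = eLpNorm (fun x => f (x - z.1)) 2 volume := by
      refine eLpNorm_congr_norm_ae ?_
      filter_upwards [coeFn_tf z f] with x hx
      rw [hx, norm_mul, norm_expTwoPi, one_mul]
    have h2 : eLpNorm (fun x => f (x - z.1)) 2 volume = eLpNorm f 2 volume :=
      eLpNorm_comp_measurePreserving (Lp.aestronglyMeasurable f)
        (measurePreserving_sub_right volume z.1)
    rw [Lp.norm_def, Lp.norm_def, h1, h2]

@[simp] lemma tfIsometry_apply (z : ℝ × ℝ) (f : L2) : tfIsometry z f = tf z f := rfl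

lemma tf_smul (z : ℝ × ℝ) (c : ℂ) (f : L2) : tf z (c • f) = c • tf z f :=
  (tfIsometry z).map_smul c f

lemma tf_zero_right (z : ℝ × ℝ) : tf z 0 = 0 := (tfIsometry z).map_zero

lemma inner_tf_tf (z : ℝ × ℝ) (f h : L2) : ⟪tf z f, tf z h⟫_ℂ = ⟪f, h⟫_ℂ :=
  (tfIsometry z).inner_map_map f h

lemma tf_tf (z w : ℝ × ℝ) (f : L2) : tf z (tf w f) = expTwoPi (z.2 * w.1) • tf (z + w) f := by
  refine Lp.ext ?_
  filter_upwards [coeFn_tf z (tf w f), ae_sub (coeFn_tf w f) z.1,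
    Lp.coeFn_smul (expTwoPi (z.2 * w.1)) (tf (z + w) f), coeFn_tf (z + w) f] with x h1 h2 h3 h4
  rw [h1, h2, h3, Pi.smul_apply, h4, smul_eq_mul, Prod.fst_add, Prod.snd_add, sub_sub,
    ← mul_assoc, ← mul_assoc, ← expTwoPi_add, ← expTwoPi_add]
  congr 2
  ring

lemma tf_zero_left (f : L2) : tf 0 f = f := by
  refine Lp.ext ?_
  filter_upwards [coeFn_tf 0 f] with x h1
  simp [h1]

lemma Mo_eq_tf (b : ℝ) (f : L2) : Mo b f = tf (0, b) f := by
  refine Lp.ext ?_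
  filter_upwards [coeFn_tf (0, b) f, coeFn_Mo b f] with x h1 h2
  simp [h1, h2]

/-- The Gabor system of `g` along the lattice `aℤ × bℤ`, indexed by `ℤ × ℤ`. -/
def gabor (a b : ℝ) (g : L2) (p : ℤ × ℤ) : L2 := tf (a * p.1, b * p.2) g

/-- Mixed frame operators commute with the time-frequency shifts along their lattice. -/
lemma HasSum.gabor_shift {a b : ℝ} {g γ f y : L2} (q : ℤ × ℤ)
    (h : HasSum (fun p => ⟪gabor a b γ p, f⟫_ℂ • gabor a b g p) y) :
    HasSum (fun p => ⟪gabor a b γ p, gabor a b f q⟫_ℂ • gabor a b g p) (gabor a b y q) := by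
  have h1 := h.mapL (tfIsometry (a * q.1, b * q.2)).toContinuousLinearMap
  rw [← (Equiv.addLeft q).hasSum_iff]
  have key (u : L2) (p : ℤ × ℤ) : gabor a b u (q + p)
      = expTwoPi (-(b * q.2 * (a * p.1))) • tf (a * q.1, b * q.2) (gabor a b u p) := by
    simp only [gabor]
    rw [tf_tf, smul_smul, ← expTwoPi_add, neg_add_cancel, expTwoPi_zero, one_smul]
    congr 1
    ext <;> simp <;> ring
  convert h1 using 1
  · funext p
    simp only [Function.comp, Equiv.coe_addLeft, key, inner_smul_left]
    simp only [gabor, inner_tf_tf, LinearIsometry.coe_toContinuousLinearMap, map_smul,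
      tfIsometry_apply, smul_smul]
    congr 1
    rw [mul_right_comm, conj_expTwoPi_mul_self, one_mul]
  · rfl

end TimeFrequencyShifts

section BesselDuality

lemma enorm_sq_eq_lintegral (f : L2) : ‖f‖ₑ ^ 2 = ∫⁻ x, ‖f x‖ₑ ^ 2 := by
  have h := eLpNorm_nnreal_pow_eq_lintegral (μ := volume) (f := f) (p := 2) two_ne_zero
  rw [Lp.enorm_def]
  simpa using h

lemma enorm_sq_eq_ofReal {E : Type*} [NormedAddCommGroup E] (x : E) :
    ‖x‖ₑ ^ 2 = ENNReal.ofReal (‖x‖ ^ 2) := by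
  rw [ENNReal.ofReal_pow (norm_nonneg x), ofReal_norm]

lemma lintegral_eq_tsum_Ioc {T : ℝ} (hT : 0 < T) (μ : Measure ℝ) (F : ℝ → ℝ≥0∞) :
    ∫⁻ x, F x ∂μ = ∑' j : ℤ, ∫⁻ x in Set.Ioc (j * T) (j * T + T), F x ∂μ := by
  have hI (j : ℤ) : Set.Ioc (j * T) (j * T + T) = Set.Ioc (j • T) ((j + 1) • T) := by
    simp [add_mul]
  simp only [hI]
  rw [← lintegral_iUnion (fun _ => measurableSet_Ioc) (Set.pairwise_disjoint_Ioc_zsmul T),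
    iUnion_Ioc_zsmul hT, Measure.restrict_univ]

lemma lintegral_eq_tsum_translates {T : ℝ} (hT : 0 < T) (F : ℝ → ℝ≥0∞) :
    ∫⁻ x, F x = ∑' m : ℤ, ∫⁻ x in Set.Ioc 0 T, F (x - T * m) := by
  rw [lintegral_eq_tsum_Ioc hT, ← (Equiv.neg ℤ).tsum_eq]
  refine tsum_congr fun m => ?_
  rw [← (measurePreserving_sub_right volume (T * m)).setLIntegral_comp_preimage_emb
    (MeasurableEquiv.subRight (T * (m : ℝ))).measurableEmbedding]
  congr 2
  ext x
  simp only [Equiv.neg_apply, Int.cast_neg, Set.mem_preimage, Set.mem_Ioc]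
  constructor <;> rintro ⟨h1, h2⟩ <;> constructor <;> linarith

/-- Parseval's identity on an interval of length `T`. -/
lemma lintegral_Ioc_eq_tsum_fourier {a T : ℝ} (hT : 0 < T) {w : ℝ → ℂ}
    (hw : MemLp w 2 (volume.restrict (Set.Ioc a (a + T)))) :
    ∫⁻ x in Set.Ioc a (a + T), ‖w x‖ₑ ^ 2 = ENNReal.ofReal T⁻¹ *
      ∑' n : ℤ, ‖∫ x in Set.Ioc a (a + T), expTwoPi (-(T⁻¹ * n * x)) * w x‖ₑ ^ 2 := by
  have hab : a < a + T := by linarith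
  have hP := hasSum_sq_fourierCoeffOn hab hw
  have hcoeff (n : ℤ) : ‖fourierCoeffOn hab w n‖ ^ 2
      = T⁻¹ ^ 2 * ‖∫ x in Set.Ioc a (a + T), expTwoPi (-(T⁻¹ * n * x)) * w x‖ ^ 2 := by
    rw [fourierCoeffOn_eq_integral, norm_smul, mul_pow, intervalIntegral.integral_of_le hab.le,
      add_sub_cancel_left, one_div, Real.norm_of_nonneg (by positivity)]
    congr 4
    funext x
    rw [fourier_coe_apply, smul_eq_mul, expTwoPi]
    congr 2
    push_cast
    field_simp
  simp only [hcoeff] at hP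
  rw [add_sub_cancel_left, smul_eq_mul, intervalIntegral.integral_of_le hab.le] at hP
  have hP' := hP.mul_left T
  rw [← mul_assoc, mul_inv_cancel₀ hT.ne', one_mul] at hP'
  have hint : Integrable (fun x => ‖w x‖ ^ 2) (volume.restrict (Set.Ioc a (a + T))) :=
    (memLp_two_iff_integrable_sq_norm hw.1).mp hw
  simp only [enorm_sq_eq_ofReal]
  rw [← ofReal_integral_eq_lintegral_ofReal hint (Eventually.of_forall fun _ => by positivity),
    ← hP'.tsum_eq, ENNReal.ofReal_tsum_of_nonneg (fun _ => by positivity) hP'.summable,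
    ← ENNReal.tsum_mul_left]
  refine tsum_congr fun n => ?_
  rw [← ENNReal.ofReal_mul (by positivity)]
  congr 1
  field_simp

lemma integral_Ioc_expTwoPi {T : ℝ} (hT : 0 < T) (n : ℤ) :
    ∫ x in Set.Ioc 0 T, expTwoPi (T⁻¹ * n * x) = if n = 0 then (T : ℂ) else 0 := by
  rw [← intervalIntegral.integral_of_le hT.le]
  split_ifs with hn
  · simp [hn]
  · have hc : (2 * Real.pi * Complex.I * (T⁻¹ * n) : ℂ) ≠ 0 := by
      simp [hn, hT.ne', Real.pi_ne_zero]
    have h (x : ℝ) : expTwoPi (T⁻¹ * n * x)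
        = Complex.exp ((2 * Real.pi * Complex.I * (T⁻¹ * n)) * x) := by
      rw [expTwoPi]; push_cast; ring_nf
    simp only [h]
    rw [integral_exp_mul_complex hc, ← h T, ← h 0]
    have : T⁻¹ * n * T = n := by field_simp
    rw [this, expTwoPi_intCast]
    simp

lemma lintegral_Ioc_trigPoly {T : ℝ} (hT : 0 < T) (S : Finset ℤ) (c : ℤ → ℂ) :
    ∫⁻ x in Set.Ioc 0 T, ‖∑ l ∈ S, c l * expTwoPi (T⁻¹ * l * x)‖ₑ ^ 2
      = ENNReal.ofReal (T * ∑ l ∈ S, ‖c l‖ ^ 2) := by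
  have hcont : Continuous fun x : ℝ => ∑ l ∈ S, c l * expTwoPi (T⁻¹ * l * x) := by fun_prop
  have hw : MemLp (fun x : ℝ => ∑ l ∈ S, c l * expTwoPi (T⁻¹ * l * x)) 2
      (volume.restrict (Set.Ioc 0 (0 + T))) := by
    refine MemLp.of_bound hcont.aestronglyMeasurable (∑ l ∈ S, ‖c l‖)
      (Eventually.of_forall fun x => ?_)
    exact (norm_sum_le _ _).trans (by simp)
  have hP := lintegral_Ioc_eq_tsum_fourier hT hw
  rw [zero_add] at hP
  rw [hP]
  have hcoef (n : ℤ) : ∫ x in Set.Ioc 0 T, expTwoPi (-(T⁻¹ * n * x)) *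
      ∑ l ∈ S, c l * expTwoPi (T⁻¹ * l * x) = if n ∈ S then c n * T else 0 := by
    have h (x : ℝ) : expTwoPi (-(T⁻¹ * n * x)) * ∑ l ∈ S, c l * expTwoPi (T⁻¹ * l * x)
        = ∑ l ∈ S, c l * expTwoPi (T⁻¹ * ((l - n : ℤ) : ℝ) * x) := by
      rw [Finset.mul_sum]
      refine Finset.sum_congr rfl fun l _ => ?_
      rw [mul_left_comm, ← expTwoPi_add]
      congr 2
      push_cast; ring
    simp only [h]
    rw [integral_finsetSum]
    · simp only [integral_const_mul, integral_Ioc_expTwoPi hT, sub_eq_zero, mul_ite, mul_zero,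
        Finset.sum_ite_eq']
    · intro l _
      refine Continuous.integrableOn_Ioc ?_
      fun_prop
  simp only [hcoef]
  rw [tsum_eq_sum (s := S) (fun n hn => by simp [hn]),
    Finset.sum_congr rfl (g := fun n => ENNReal.ofReal (T ^ 2 * ‖c n‖ ^ 2)) fun n hn => by
      rw [if_pos hn, enorm_sq_eq_ofReal, norm_mul, Complex.norm_real, Real.norm_of_nonneg hT.le]
      ring_nf,
    ← ENNReal.ofReal_sum_of_nonneg (fun _ _ => by positivity),
    ← ENNReal.ofReal_mul (by positivity), ← Finset.mul_sum]
  congr 1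
  field_simp

lemma IsBessel.tsum_enorm_sq_inner_le {ι H : Type*} [NormedAddCommGroup H]
    [InnerProductSpace ℂ H] {u : ι → H} {B : ℝ} (hu : IsBessel u B) (f : H) :
    ∑' i, ‖⟪u i, f⟫_ℂ‖ₑ ^ 2 ≤ ENNReal.ofReal B * ‖f‖ₑ ^ 2 := by
  rw [ENNReal.tsum_eq_iSup_sum]
  refine iSup_le fun F => ?_
  simp only [enorm_sq_eq_ofReal]
  rw [← ENNReal.ofReal_sum_of_nonneg (fun _ _ => by positivity), ← ENNReal.ofReal_mul hu.1]
  exact ENNReal.ofReal_le_ofReal (hu.sum_sq_norm_inner_le F f)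

lemma norm_sq_sum_of_pairwise_orthogonal {ι H : Type*} [NormedAddCommGroup H]
    [InnerProductSpace ℂ H] (F : Finset ι) (v : ι → H)
    (hv : Pairwise fun i j => ⟪v i, v j⟫_ℂ = 0) :
    ‖∑ i ∈ F, v i‖ ^ 2 = ∑ i ∈ F, ‖v i‖ ^ 2 := by
  classical
  induction F using Finset.induction_on with
  | empty => simp
  | insert a F ha ih =>
    rw [Finset.sum_insert ha, Finset.sum_insert ha, ← ih]
    have h : ⟪v a, ∑ i ∈ F, v i⟫_ℂ = 0 := by
      rw [inner_sum]
      exact Finset.sum_eq_zero fun i hi => hv fun h => ha (h ▸ hi)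
    have := norm_add_sq_eq_norm_sq_add_norm_sq_of_inner_eq_zero (𝕜 := ℂ) (v a) _ h
    simpa only [sq] using this


lemma inner_tf_neg_fst (a : ℝ) (f u : L2) : ⟪f, tf (-a, 0) u⟫_ℂ = ⟪tf (a, 0) f, u⟫_ℂ := by
  rw [← inner_tf_tf (a, 0) f, tf_tf]
  simp [← Prod.zero_eq_mk, tf_zero_left]

/-- Testing the Bessel inequality on a function supported on `β⁻¹ℤ`-translates of a set `E` of
diameter less than `β⁻¹` bounds the adjoint system over `E`. -/
lemma IsBessel.tsum_lintegral_fiber_le {α β B : ℝ} (hβ : 0 < β) {g : L2}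
    (hg : IsBessel (gabor α β g) B) {a : ℝ} {E : Set ℝ} (hE : MeasurableSet E)
    (hEI : E ⊆ Set.Ioc a (a + β⁻¹)) (S : Finset ℤ) {C : ℤ → ℝ → ℂ} {K : ℤ → ℝ}
    (hC : ∀ k, Continuous (C k)) (hK : ∀ k x, ‖C k x‖ ≤ K k) :
    ∑' m : ℤ, ∫⁻ x in E, ‖∑ k ∈ S, C k x * g (x - (β⁻¹ * k + α * m))‖ₑ ^ 2
      ≤ ENNReal.ofReal (β * B) * ∑ k ∈ S, ∫⁻ x in E, ‖C k x‖ₑ ^ 2 := by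
  have hEfin : volume E ≠ ∞ := ((measure_mono hEI).trans_lt measure_Ioc_lt_top).ne
  have : IsFiniteMeasure (volume.restrict E) := ⟨by simpa using hEfin.lt_top⟩
  have hmem (k : ℤ) : MemLp (E.indicator fun x => conj (C k x)) 2 volume := by
    rw [memLp_indicator_iff_restrict hE]
    refine MemLp.of_bound (by fun_prop) (K k) (Eventually.of_forall fun x => ?_)
    simpa using hK k x
  set U : ℤ → L2 := fun k => (hmem k).toLp _ with hU
  have hUae (k : ℤ) : U k =ᵐ[volume] E.indicator fun x => conj (C k x) := (hmem k).coeFn_toLp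
  set V : ℤ → L2 := fun k => tf (-(β⁻¹ * k), 0) (U k) with hV
  set h : ℤ → ℝ → ℂ := fun m x => ∑ k ∈ S, C k x * g (x - (β⁻¹ * k + α * m)) with hh
  have horth : Pairwise fun i j => ⟪V i, V j⟫_ℂ = 0 := by
    intro i j hij
    rw [L2.inner_def]
    refine integral_eq_zero_of_ae ?_
    filter_upwards [coeFn_tf (-(β⁻¹ * i), 0) (U i), coeFn_tf (-(β⁻¹ * j), 0) (U j),
      ae_sub (hUae i) (-(β⁻¹ * i)), ae_sub (hUae j) (-(β⁻¹ * j))] with x h1 h2 h3 h4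
    simp only [hV, h1, h2, h3, h4, Pi.zero_apply, zero_mul, expTwoPi_zero, one_mul]
    by_cases hi : x - -(β⁻¹ * i) ∈ E
    · by_cases hj : x - -(β⁻¹ * j) ∈ E
      · exfalso
        obtain ⟨hi1, hi2⟩ := hEI hi
        obtain ⟨hj1, hj2⟩ := hEI hj
        have hβ' : 0 < β⁻¹ := inv_pos.mpr hβ
        have e1 : (i : ℝ) < j + 1 := lt_of_mul_lt_mul_left (by linarith) hβ'.le
        have e2 : (j : ℝ) < i + 1 := lt_of_mul_lt_mul_left (by linarith) hβ'.le
        norm_cast at e1 e2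
        lia
      · rw [Set.indicator_of_notMem hj, inner_zero_right]
    · rw [Set.indicator_of_notMem hi, inner_zero_left]
  have hnormV (k : ℤ) : ‖V k‖ₑ ^ 2 = ∫⁻ x in E, ‖C k x‖ₑ ^ 2 := by
    have h1 : ‖V k‖ = ‖U k‖ := (tfIsometry _).norm_map (U k)
    rw [enorm_sq_eq_ofReal, h1, ← enorm_sq_eq_ofReal, enorm_sq_eq_lintegral,
      ← lintegral_indicator hE]
    refine lintegral_congr_ae ?_
    filter_upwards [hUae k] with x hx
    rw [hx]
    by_cases hxE : x ∈ E <;> simp [hxE]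
  have hnorm : ‖∑ k ∈ S, V k‖ₑ ^ 2 = ∑ k ∈ S, ∫⁻ x in E, ‖C k x‖ₑ ^ 2 := by
    rw [enorm_sq_eq_ofReal, norm_sq_sum_of_pairwise_orthogonal S V horth,
      ENNReal.ofReal_sum_of_nonneg (fun _ _ => by positivity)]
    exact Finset.sum_congr rfl fun k _ => by rw [← enorm_sq_eq_ofReal, hnormV]
  have hinner (m n : ℤ) : ‖⟪gabor α β g (m, n), ∑ k ∈ S, V k⟫_ℂ‖ₑ
      = ‖∫ x in Set.Ioc a (a + β⁻¹), expTwoPi (-(β⁻¹⁻¹ * n * x)) *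
          E.indicator (fun x => conj (h m x)) x‖ₑ := by
    have h1 : ⟪gabor α β g (m, n), ∑ k ∈ S, V k⟫_ℂ
        = ∑ k ∈ S, ⟪tf (β⁻¹ * k + α * m, β * n) g, U k⟫_ℂ := by
      rw [inner_sum]
      refine Finset.sum_congr rfl fun k _ => ?_
      rw [hV, inner_tf_neg_fst, gabor, tf_tf]
      simp
    have h2 : ⟪gabor α β g (m, n), ∑ k ∈ S, V k⟫_ℂ = expTwoPi (β * n * (α * m)) *
        ∫ x in Set.Ioc a (a + β⁻¹), expTwoPi (-(β⁻¹⁻¹ * n * x)) *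
          E.indicator (fun x => conj (h m x)) x := by
      rw [setIntegral_eq_integral_of_forall_compl_eq_zero, ← integral_const_mul, h1]
      · simp only [L2.inner_def]
        rw [← integral_finsetSum _ fun k _ => L2.integrable_inner _ _]
        refine integral_congr_ae ?_
        filter_upwards [ae_all_iff.mpr fun k : ℤ => coeFn_tf (β⁻¹ * k + α * m, β * n) g,
          ae_all_iff.mpr hUae] with x hx1 hx2
        by_cases hxE : x ∈ E
        · simp only [hx1, hx2, Set.indicator_of_mem hxE, RCLike.inner_apply, hh, map_sum, map_mul,
            Finset.mul_sum]
          refine Finset.sum_congr rfl fun k _ => ?_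
          rw [conj_expTwoPi]
          have hphase : expTwoPi (-(β * n * (x - (β⁻¹ * k + α * m))))
              = expTwoPi (β * n * (α * m)) * expTwoPi (-(β⁻¹⁻¹ * n * x)) := by
            rw [← expTwoPi_add, ← mul_one (expTwoPi (_ + _)), ← expTwoPi_intCast (n * k),
              ← expTwoPi_add]
            congr 1
            push_cast
            field_simp
            ring
          rw [hphase]
          ring
        · simp [hx2, hxE]
      · intro x hx
        rw [Set.indicator_of_notMem fun h => hx (hEI h), mul_zero]
    rw [h2, enorm_mul]
    have : ‖expTwoPi (β * n * (α * m))‖ₑ = 1 := by rw [← ofReal_norm]; simp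
    rw [this, one_mul]
  have hhmem (m : ℤ) : MemLp (fun x => conj (h m x)) 2 volume := by
    refine MemLp.star (f := h m) ?_
    refine memLp_finsetSum _ fun k _ => ?_
    have hg' := memLp_translate (β⁻¹ * k + α * m) g
    refine hg'.of_le_mul (c := K k) ((hC k).aestronglyMeasurable.mul hg'.1)
      (Eventually.of_forall fun x => ?_)
    rw [norm_mul]
    exact mul_le_mul_of_nonneg_right (hK k x) (norm_nonneg _)
  have hfiber (m : ℤ) : ∫⁻ x in E, ‖h m x‖ₑ ^ 2
      = ENNReal.ofReal β * ∑' n : ℤ, ‖⟪gabor α β g (m, n), ∑ k ∈ S, V k⟫_ℂ‖ₑ ^ 2 := by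
    have hP := lintegral_Ioc_eq_tsum_fourier (a := a) (inv_pos.mpr hβ)
      (((hhmem m).indicator hE).restrict (Set.Ioc a (a + β⁻¹)))
    simp only [← hinner] at hP
    rw [inv_inv] at hP
    rw [← hP, ← lintegral_indicator hE, ← lintegral_indicator measurableSet_Ioc]
    refine lintegral_congr fun x => ?_
    by_cases hxE : x ∈ E
    · simp [hxE, hEI hxE]
    · simp [Set.indicator_apply, hxE]
  calc ∑' m : ℤ, ∫⁻ x in E, ‖h m x‖ₑ ^ 2
      = ENNReal.ofReal β * ∑' p : ℤ × ℤ, ‖⟪gabor α β g p, ∑ k ∈ S, V k⟫_ℂ‖ₑ ^ 2 := by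
        rw [ENNReal.tsum_prod', ← ENNReal.tsum_mul_left]
        exact tsum_congr hfiber
    _ ≤ ENNReal.ofReal β * (ENNReal.ofReal B * ‖∑ k ∈ S, V k‖ₑ ^ 2) := by
        gcongr
        exact hg.tsum_enorm_sq_inner_le _
    _ = _ := by rw [hnorm, ← mul_assoc, ← ENNReal.ofReal_mul hβ.le]

/-- **Bessel duality**: if `g` generates a Bessel system along `αℤ × βℤ`, then it generates one
along the adjoint lattice `β⁻¹ℤ × α⁻¹ℤ`. -/
lemma IsBessel.adjoint_lattice {α β B : ℝ} (hα : 0 < α) (hβ : 0 < β) {g : L2}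
    (hg : IsBessel (gabor α β g) B) : IsBessel (gabor β⁻¹ α⁻¹ g) (α * β * B) := by
  refine ⟨mul_nonneg (mul_nonneg hα.le hβ.le) hg.1, fun F c => ?_⟩
  classical
  set S := F.image Prod.fst
  set S' := F.image Prod.snd
  set d : ℤ × ℤ → ℂ := fun p => if p ∈ F then c p else 0 with hd
  have hFS : F ⊆ S ×ˢ S' := fun p hp =>
    Finset.mem_product.mpr ⟨Finset.mem_image_of_mem _ hp, Finset.mem_image_of_mem _ hp⟩
  have hsum1 : ∑ p ∈ F, c p • gabor β⁻¹ α⁻¹ g p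
      = ∑ p ∈ S ×ˢ S', d p • gabor β⁻¹ α⁻¹ g p := by
    rw [← Finset.sum_subset hFS fun p _ hp => by simp [hd, hp]]
    exact Finset.sum_congr rfl fun p hp => by simp [hd, hp]
  have hsum2 : ∑ p ∈ F, ‖c p‖ ^ 2 = ∑ k ∈ S, ∑ l ∈ S', ‖d (k, l)‖ ^ 2 := by
    rw [← Finset.sum_product' S S' fun k l => ‖d (k, l)‖ ^ 2,
      ← Finset.sum_subset hFS fun p _ hp => by simp [hd, hp]]
    exact Finset.sum_congr rfl fun p hp => by simp [hd, hp]
  set H := ∑ p ∈ F, c p • gabor β⁻¹ α⁻¹ g p with hH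
  set b : ℤ → ℤ → ℂ := fun k l => d (k, l) * expTwoPi (-(α⁻¹ * l * (β⁻¹ * k))) with hb
  set C : ℤ → ℝ → ℂ := fun k x => ∑ l ∈ S', b k l * expTwoPi (α⁻¹ * l * x) with hC
  have hCcont (k : ℤ) : Continuous (C k) := by simp only [hC]; fun_prop
  have hCbd (k : ℤ) (x : ℝ) : ‖C k x‖ ≤ ∑ l ∈ S', ‖b k l‖ := by
    exact (norm_sum_le _ _).trans (by simp)
  have hCper (k m : ℤ) (x : ℝ) : C k (x - α * m) = C k x := by
    refine Finset.sum_congr rfl fun l _ => ?_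
    rw [← mul_one (expTwoPi (α⁻¹ * l * (x - α * m))), ← expTwoPi_intCast (l * m), ← expTwoPi_add]
    congr 2
    push_cast
    field_simp
    ring
  have hHae : H =ᵐ[volume] fun x => ∑ k ∈ S, C k x * g (x - β⁻¹ * k) := by
    rw [hsum1]
    filter_upwards [Lp.coeFn_finsetSum (S ×ˢ S') fun p => d p • gabor β⁻¹ α⁻¹ g p,
      ae_all_iff.mpr fun p : ℤ × ℤ => Lp.coeFn_smul (d p) (gabor β⁻¹ α⁻¹ g p),
      ae_all_iff.mpr fun p : ℤ × ℤ => coeFn_tf (β⁻¹ * p.1, α⁻¹ * p.2) g] with x h1 h2 h3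
    rw [h1, Finset.sum_apply, Finset.sum_product]
    refine Finset.sum_congr rfl fun k _ => ?_
    rw [Finset.sum_mul]
    refine Finset.sum_congr rfl fun l _ => ?_
    rw [h2, Pi.smul_apply, gabor, h3, smul_eq_mul, mul_sub, sub_eq_neg_add, expTwoPi_add]
    ring
  have hbound : ‖H‖ₑ ^ 2 ≤ ENNReal.ofReal (α * β * B * ∑ p ∈ F, ‖c p‖ ^ 2) := by
    have hI (j : ℤ) := hg.tsum_lintegral_fiber_le hβ
      (E := Set.Ioc (j * β⁻¹) (j * β⁻¹ + β⁻¹) ∩ Set.Ioc 0 α)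
      (measurableSet_Ioc.inter measurableSet_Ioc) Set.inter_subset_left S hCcont hCbd
    calc ‖H‖ₑ ^ 2
        = ∑' m : ℤ, ∫⁻ x in Set.Ioc 0 α, ‖∑ k ∈ S, C k x * g (x - (β⁻¹ * k + α * m))‖ₑ ^ 2 := by
          have h1 : (fun x => ‖H x‖ₑ ^ 2)
              =ᵐ[volume] fun x => ‖∑ k ∈ S, C k x * g (x - β⁻¹ * k)‖ₑ ^ 2 :=
            hHae.fun_comp fun z => ‖z‖ₑ ^ 2
          rw [enorm_sq_eq_lintegral, lintegral_congr_ae h1,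
            lintegral_eq_tsum_translates hα]
          refine tsum_congr fun m => lintegral_congr fun x => ?_
          simp only [hCper, sub_sub, add_comm]
      _ = ∑' j : ℤ, ∑' m : ℤ, ∫⁻ x in Set.Ioc (j * β⁻¹) (j * β⁻¹ + β⁻¹) ∩ Set.Ioc 0 α,
            ‖∑ k ∈ S, C k x * g (x - (β⁻¹ * k + α * m))‖ₑ ^ 2 := by
          rw [ENNReal.tsum_comm]
          refine tsum_congr fun m => ?_
          rw [lintegral_eq_tsum_Ioc (inv_pos.mpr hβ)]
          simp only [Measure.restrict_restrict measurableSet_Ioc]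
      _ ≤ ∑' j : ℤ, ENNReal.ofReal (β * B) *
            ∑ k ∈ S, ∫⁻ x in Set.Ioc (j * β⁻¹) (j * β⁻¹ + β⁻¹) ∩ Set.Ioc 0 α, ‖C k x‖ₑ ^ 2 :=
          ENNReal.tsum_le_tsum hI
      _ = ENNReal.ofReal (β * B) * ∑ k ∈ S, ∫⁻ x in Set.Ioc 0 α, ‖C k x‖ₑ ^ 2 := by
          rw [ENNReal.tsum_mul_left, Summable.tsum_finsetSum fun _ _ => ENNReal.summable]
          congr 1
          refine Finset.sum_congr rfl fun k _ => ?_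
          rw [lintegral_eq_tsum_Ioc (inv_pos.mpr hβ)]
          simp only [Measure.restrict_restrict measurableSet_Ioc]
      _ = _ := by
          simp only [hC, lintegral_Ioc_trigPoly hα]
          rw [← ENNReal.ofReal_sum_of_nonneg
              (fun _ _ => mul_nonneg hα.le (Finset.sum_nonneg fun _ _ => by positivity)),
            ← ENNReal.ofReal_mul (mul_nonneg hβ.le hg.1), ← Finset.mul_sum, hsum2]
          simp only [hb, norm_mul, norm_expTwoPi, mul_one]
          congr 1
          ring
  rw [enorm_sq_eq_ofReal] at hbound
  refine (ENNReal.ofReal_le_ofReal_iff ?_).mp hbound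
  exact mul_nonneg (mul_nonneg (mul_nonneg hα.le hβ.le) hg.1)
    (Finset.sum_nonneg fun _ _ => by positivity)

end BesselDuality

section FrameSequences

/-- The closed linear span of the Gabor system of `g` along `αℤ × βℤ`. -/
def gaborClosedSpan (α β : ℝ) (g : L2) : Submodule ℂ L2 :=
  (Submodule.span ℂ (Set.range (gabor α β g))).topologicalClosure

lemma gabor_mem_gaborClosedSpan (α β : ℝ) (g : L2) (p : ℤ × ℤ) :
    gabor α β g p ∈ gaborClosedSpan α β g :=
  Submodule.le_topologicalClosure _ (Submodule.subset_span ⟨p, rfl⟩)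

lemma gaborSpan_sepLattice (α β : ℝ) (g : L2) :
    gaborSpan g (sepLattice α β) = gaborClosedSpan α β g := by
  have h : (fun z => tf z g) '' sepLattice α β = Set.range (gabor α β g) := by
    ext f
    constructor
    · rintro ⟨_, ⟨k, l, rfl⟩, rfl⟩
      exact ⟨(k, l), rfl⟩
    · rintro ⟨p, rfl⟩
      exact ⟨_, ⟨p.1, p.2, rfl⟩, rfl⟩
  rw [gaborSpan, h, gaborClosedSpan, Submodule.topologicalClosure_coe]

/-- The parametrization of `αℤ × βℤ` by `ℤ × ℤ`. -/
def sepLatticeEquiv {α β : ℝ} (hα : 0 < α) (hβ : 0 < β) : ℤ × ℤ ≃ sepLattice α β :=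
  Equiv.ofBijective (fun p => ⟨(α * p.1, β * p.2), p.1, p.2, rfl⟩) <| by
    constructor
    · intro p q h
      have h' := congrArg Subtype.val h
      simpa [Prod.ext_iff, hα.ne', hβ.ne'] using h'
    · rintro ⟨_, k, l, rfl⟩
      exact ⟨(k, l), rfl⟩

/-- A frame sequence is a Bessel family satisfying the lower frame bound on its closed span. -/
lemma IsFrameSeq.exists_bounds {α β : ℝ} (hα : 0 < α) (hβ : 0 < β) {g : L2}
    (h : IsFrameSeq g (sepLattice α β)) :
    ∃ A B : ℝ, 0 < A ∧ IsBessel (gabor α β g) B ∧ ∀ f ∈ gaborClosedSpan α β g,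
      A * ‖f‖ ^ 2 ≤ ∑' p, ‖⟪gabor α β g p, f⟫_ℂ‖ ^ 2 := by
  obtain ⟨A, B, hA, hB, hAB⟩ := h
  rw [gaborSpan_sepLattice] at hAB
  have htsum (f : L2) : ∑' lam : sepLattice α β, ‖⟪tf (lam : ℝ × ℝ) g, f⟫_ℂ‖ ^ 2
      = ∑' p, ‖⟪gabor α β g p, f⟫_ℂ‖ ^ 2 :=
    ((sepLatticeEquiv hα hβ).tsum_eq
      fun lam : sepLattice α β => ‖⟪tf (lam : ℝ × ℝ) g, f⟫_ℂ‖ ^ 2).symm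
  simp only [htsum] at hAB
  refine ⟨A, B, hA, .of_sum_sq_norm_inner_le hB.le fun F f => ?_, fun f hf => (hAB f hf).1⟩
  have : CompleteSpace (gaborClosedSpan α β g) :=
    (Submodule.isClosed_topologicalClosure _).completeSpace_coe
  set f' := (gaborClosedSpan α β g).starProjection f with hf'
  have hf'mem : f' ∈ gaborClosedSpan α β g := Submodule.starProjection_apply_mem _ f
  have hinner (p : ℤ × ℤ) : ⟪gabor α β g p, f⟫_ℂ = ⟪gabor α β g p, f'⟫_ℂ := by
    rw [hf', ← Submodule.inner_starProjection_left_eq_right,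
      Submodule.starProjection_eq_self_iff.mpr (gabor_mem_gaborClosedSpan α β g p)]
  have hnorm : ‖f'‖ ≤ ‖f‖ := Submodule.norm_starProjection_apply_le _ f
  simp only [hinner]
  refine le_trans ?_ (mul_le_mul_of_nonneg_left (pow_le_pow_left₀ (norm_nonneg _) hnorm 2) hB.le)
  by_cases h0 : f' = 0
  · simp [h0]
  obtain ⟨h1, h2⟩ := hAB f' hf'mem
  have hpos : 0 < A * ‖f'‖ ^ 2 := by positivity
  have hs : Summable fun p => ‖⟪gabor α β g p, f'⟫_ℂ‖ ^ 2 := by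
    by_contra hs
    rw [tsum_eq_zero_of_not_summable hs] at h1
    linarith
  exact (hs.sum_le_tsum F fun _ _ => by positivity).trans h2

/-- The canonical dual window of a Gabor frame sequence generates a Bessel family. -/
lemma IsDualWindow.exists_isBessel {α β A B : ℝ} (hα : 0 < α) (hβ : 0 < β) {g γ : L2}
    (hγ : IsDualWindow g γ α β) (hA : 0 < A) (hg : IsBessel (gabor α β g) B)
    (hlow : ∀ f ∈ gaborClosedSpan α β g, A * ‖f‖ ^ 2 ≤ ∑' p, ‖⟪gabor α β g p, f⟫_ℂ‖ ^ 2) :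
    IsBessel (gabor α β γ) (B / A ^ 2) := by
  obtain ⟨hmem, hsum⟩ := hγ
  rw [gaborSpan_sepLattice] at hmem
  have hsum' : HasSum (fun p => ⟪gabor α β g p, γ⟫_ℂ • gabor α β g p) g :=
    (sepLatticeEquiv hα hβ).hasSum_iff.mpr hsum
  obtain ⟨S, hS⟩ := hg.exists_mixed_frame_operator hg
  have hSγ (p : ℤ × ℤ) : S (gabor α β γ p) = gabor α β g p :=
    (hS _).unique (hsum'.gabor_shift p)
  have hinv (p : ℤ × ℤ) : gabor α β γ p ∈ gaborClosedSpan α β g := by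
    have hle : gaborClosedSpan α β g ≤ (gaborClosedSpan α β g).comap
        (tfIsometry (α * p.1, β * p.2)).toLinearMap := by
      refine Submodule.topologicalClosure_minimal _ (Submodule.span_le.mpr ?_) ?_
      · rintro _ ⟨q, rfl⟩
        have h : tf (α * p.1, β * p.2) (gabor α β g q) ∈ gaborClosedSpan α β g := by
          rw [gabor, tf_tf]
          refine Submodule.smul_mem _ _ ?_
          have hpq : tf ((α * p.1, β * p.2) + (α * q.1, β * q.2)) g = gabor α β g (p + q) := by
            rw [gabor]
            congr 1
            ext <;> simp <;> ring
          rw [hpq]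
          exact gabor_mem_gaborClosedSpan α β g (p + q)
        exact h
      · exact (Submodule.isClosed_topologicalClosure _).preimage
          (tfIsometry (α * p.1, β * p.2)).continuous
    exact hle hmem
  have hcoer (f : L2) (hf : f ∈ gaborClosedSpan α β g) : A * ‖f‖ ≤ ‖S f‖ := by
    have h1 : HasSum (fun p => ((‖⟪gabor α β g p, f⟫_ℂ‖ ^ 2 : ℝ) : ℂ)) ⟪f, S f⟫_ℂ := by
      have h : HasSum (fun p => ⟪f, ⟪gabor α β g p, f⟫_ℂ • gabor α β g p⟫_ℂ) ⟪f, S f⟫_ℂ :=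
        (hS f).mapL (innerSL ℂ f)
      convert h using 2 with p
      rw [inner_smul_right, ← inner_conj_symm f, Complex.mul_conj',
        ofReal_pow]
    have h2 : (⟪f, S f⟫_ℂ).re = ∑' p, ‖⟪gabor α β g p, f⟫_ℂ‖ ^ 2 := by
      simpa only [ofReal_re] using (Complex.hasSum_re h1).tsum_eq.symm
    have h3 : A * ‖f‖ ^ 2 ≤ ‖f‖ * ‖S f‖ := by
      have h4 := (Complex.re_le_norm _).trans (norm_inner_le_norm (𝕜 := ℂ) f (S f))
      rw [h2] at h4
      exact (hlow f hf).trans h4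
    rcases (norm_nonneg f).eq_or_lt with h0 | h0
    · rw [← h0, mul_zero]; exact norm_nonneg _
    · exact le_of_mul_le_mul_left (by linarith [h3]) h0
  refine ⟨div_nonneg hg.1 (sq_nonneg A), fun F c => ?_⟩
  have hx : ∑ p ∈ F, c p • gabor α β γ p ∈ gaborClosedSpan α β g :=
    Submodule.sum_mem _ fun p _ => Submodule.smul_mem _ _ (hinv p)
  have h1 := hcoer _ hx
  rw [map_sum] at h1
  simp only [map_smul, hSγ] at h1
  have h2 := (pow_le_pow_left₀ (by positivity) h1 2).trans (hg.2 F c)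
  rw [div_mul_eq_mul_div, le_div_iff₀ (by positivity)]
  linarith [mul_pow A ‖∑ p ∈ F, c p • gabor α β γ p‖ 2]

end FrameSequences

section DirectSum

variable {g : L2} {α β : ℝ} {ν : ℕ}

lemma Lsub_le_iff (g : L2) (α β : ℝ) (ν s : ℕ) {W : Submodule ℂ L2} (hW : IsClosed (W : Set L2)) :
    Lsub g α β ν s ≤ W ↔ ∀ k n : ℤ, n ≡ s [ZMOD ν] → tf ((k : ℝ) / β, (n : ℝ) / α) g ∈ W := by
  constructor
  · intro h k n hn
    refine h (Submodule.le_topologicalClosure _ (Submodule.subset_span ?_))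
    obtain ⟨l, hl⟩ := hn.symm.dvd
    refine ⟨k, l, ?_⟩
    rw [eq_add_of_sub_eq hl]
    push_cast
    rw [mul_comm (ν : ℝ)]
  · intro h
    refine Submodule.topologicalClosure_minimal _ (Submodule.span_le.mpr ?_) hW
    rintro _ ⟨k, l, rfl⟩
    have := h k (l * ν + s) (by simp [Int.ModEq])
    push_cast at this
    exact this

lemma Ksub_le_iff (g : L2) (α β : ℝ) {W : Submodule ℂ L2} (hW : IsClosed (W : Set L2)) :
    Ksub g α β ≤ W ↔ ∀ k n : ℤ, tf ((k : ℝ) / β, (n : ℝ) / α) g ∈ W := by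
  constructor
  · exact fun h k n => h (Submodule.le_topologicalClosure _ (Submodule.subset_span ⟨k, n, rfl⟩))
  · intro h
    refine Submodule.topologicalClosure_minimal _ (Submodule.span_le.mpr ?_) hW
    rintro _ ⟨k, l, rfl⟩
    exact h k l

/-- A bounded operator that keeps the shifts of `g` with modulation index in `νℤ` and kills the
others forces the direct sum decomposition. -/
lemma directSum_of_projection (hν : 1 ≤ ν) (Q : L2 →L[ℂ] L2)
    (hQ : ∀ k n : ℤ, Q (tf ((k : ℝ) / β, (n : ℝ) / α) g)
      = if (ν : ℤ) ∣ n then tf ((k : ℝ) / β, (n : ℝ) / α) g else 0) :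
    Ksub g α β = (⨆ s : Fin ν, Lsub g α β ν s) ∧
    ∀ i : Fin ν, Lsub g α β ν i ⊓ (⨆ j : Fin ν, ⨆ _ : j ≠ i, Lsub g α β ν j) = ⊥ := by
  let R (s : ℕ) : L2 →L[ℂ] L2 :=
    (tfIsometry (0, (s : ℝ) / α)).toContinuousLinearMap ∘L Q ∘L
      (tfIsometry (0, -((s : ℝ) / α))).toContinuousLinearMap
  have hR (s : ℕ) (k n : ℤ) : R s (tf ((k : ℝ) / β, (n : ℝ) / α) g)
      = if n ≡ s [ZMOD ν] then tf ((k : ℝ) / β, (n : ℝ) / α) g else 0 := by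
    have h1 : tf (0, -((s : ℝ) / α)) (tf ((k : ℝ) / β, (n : ℝ) / α) g)
        = expTwoPi (-((s : ℝ) / α) * (k / β)) •
          tf ((k : ℝ) / β, ((n - s : ℤ) : ℝ) / α) g := by
      rw [tf_tf]
      congr 2
      ext <;> simp
      ring
    have h2 : tf (0, (s : ℝ) / α) (tf ((k : ℝ) / β, ((n - s : ℤ) : ℝ) / α) g)
        = expTwoPi ((s : ℝ) / α * (k / β)) • tf ((k : ℝ) / β, (n : ℝ) / α) g := by
      rw [tf_tf]
      congr 2
      ext <;> simp
      ring
    have h3 : (ν : ℤ) ∣ n - s ↔ n ≡ s [ZMOD ν] := (Int.modEq_comm.trans Int.modEq_iff_dvd).symm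
    change tf (0, (s : ℝ) / α) (Q (tf (0, -((s : ℝ) / α)) (tf ((k : ℝ) / β, (n : ℝ) / α) g))) = _
    rw [h1, map_smul, hQ, tf_smul]
    simp only [h3]
    split_ifs
    · rw [h2, smul_smul, ← expTwoPi_add, neg_mul, neg_add_cancel, expTwoPi_zero, one_smul]
    · rw [tf_zero_right, smul_zero]
  have hclosed (s : ℕ) : IsClosed (Lsub g α β ν s : Set L2) :=
    Submodule.isClosed_topologicalClosure _
  have hgen (s : ℕ) := (Lsub_le_iff g α β ν s (hclosed s)).mp le_rfl
  have hν' : (0 : ℤ) < ν := by exact_mod_cast hν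
  refine ⟨le_antisymm ?_ ?_, fun i => ?_⟩
  · have hmem (s : ℕ) : Ksub g α β ≤ (Lsub g α β ν s).comap (R s).toLinearMap := by
      refine (Ksub_le_iff g α β ((hclosed s).preimage (R s).continuous)).mpr fun k n => ?_
      change R s (tf ((k : ℝ) / β, (n : ℝ) / α) g) ∈ Lsub g α β ν s
      rw [hR]
      split_ifs with h
      · exact hgen s k n h
      · exact Submodule.zero_mem _
    have hid : Ksub g α β ≤ (∑ s : Fin ν, R s - ContinuousLinearMap.id ℂ L2).ker := by
      refine (Ksub_le_iff g α β (ContinuousLinearMap.isClosed_ker _)).mpr fun k n => ?_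
      change (∑ s : Fin ν, R s - ContinuousLinearMap.id ℂ L2) _ = 0
      rw [sub_apply, sum_apply, sub_eq_zero]
      simp only [hR]
      let r : Fin ν := ⟨(n % ν).toNat, by
        have := Int.emod_lt_of_pos n hν'
        have := Int.emod_nonneg n hν'.ne'
        lia⟩
      have hr : ((r : ℕ) : ℤ) = n % ν := Int.toNat_of_nonneg (Int.emod_nonneg n hν'.ne')
      rw [Finset.sum_eq_single r]
      · rw [if_pos (by rw [hr]; exact (Int.mod_modEq n ν).symm)]; rfl
      · intro s _ hs
        refine if_neg fun h => hs (Fin.ext ?_)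
        have h' : n % ν = s := by
          rw [h.eq, Int.emod_eq_of_lt (by positivity) (by exact_mod_cast s.isLt)]
        exact_mod_cast h'.symm.trans hr.symm
      · exact fun h => absurd (Finset.mem_univ r) h
    intro f hf
    have h1 : (∑ s : Fin ν, R s - ContinuousLinearMap.id ℂ L2) f = 0 := hid hf
    rw [sub_apply, sum_apply, sub_eq_zero] at h1
    have h2 : ∑ s : Fin ν, R s f = f := h1
    rw [← h2]
    exact Submodule.sum_mem _ fun s _ =>
      Submodule.mem_iSup_of_mem (p := fun s : Fin ν => Lsub g α β ν s) s (hmem s hf)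
  · have hK : IsClosed (Ksub g α β : Set L2) := Submodule.isClosed_topologicalClosure _
    exact iSup_le fun s => (Lsub_le_iff g α β ν s hK).mpr fun k n _ =>
      (Ksub_le_iff g α β hK).mp le_rfl k n
  · have hid : Lsub g α β ν i ≤ (R i - ContinuousLinearMap.id ℂ L2).ker := by
      refine (Lsub_le_iff g α β ν i (ContinuousLinearMap.isClosed_ker _)).mpr fun k n h => ?_
      change R i _ - _ = 0
      rw [hR, if_pos h]
      exact sub_self _
    have hzero : (⨆ j : Fin ν, ⨆ _ : j ≠ i, Lsub g α β ν j) ≤ (R i).ker := by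
      refine iSup₂_le fun j hj =>
        (Lsub_le_iff g α β ν j (ContinuousLinearMap.isClosed_ker _)).mpr fun k n h => ?_
      change R i _ = 0
      rw [hR]
      refine if_neg fun h' => hj (Fin.ext ?_)
      have h3 : ((j : ℕ) : ℤ) % ν = ((i : ℕ) : ℤ) % ν := h.symm.trans h'
      rw [Int.emod_eq_of_lt (by positivity) (by exact_mod_cast j.isLt),
        Int.emod_eq_of_lt (by positivity) (by exact_mod_cast i.isLt)] at h3
      exact_mod_cast h3
    refine (Submodule.eq_bot_iff _).mpr fun f hf => ?_
    have h1 : R i f - f = 0 := hid hf.1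
    have h2 : R i f = 0 := hzero hf.2
    rwa [h2, zero_sub, neg_eq_zero] at h1

end DirectSum

/-- (ii) ⇒ (iii) of Theorem 4.4: the projection conditions imply
`𝒦 = ℒ_0 ∔ ⋯ ∔ ℒ_{ν-1}`. -/
theorem statement_12 (g : L2) (hg : InS0 g) (α β : ℝ) (hα : 0 < α) (hβ : 0 < β)
    (hframe : IsFrameSeq g (sepLattice α β)) (γ : L2) (hγ : IsDualWindow g γ α β)
    (ν : ℕ) (hν : 1 ≤ ν)
    (hP : ∀ s : ℕ, s < ν →
      HasSum (fun kl : ℤ × ℤ =>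
        ((((α * β)⁻¹ : ℝ) : ℂ) *
            ⟪tf ((kl.1 : ℝ) / β, (kl.2 : ℝ) * (ν : ℝ) / α) γ, Mo ((s : ℝ) / α) g⟫_ℂ)
          • tf ((kl.1 : ℝ) / β, (kl.2 : ℝ) * (ν : ℝ) / α) g)
        (if s = 0 then g else 0)) :
    Ksub g α β = (⨆ s : Fin ν, Lsub g α β ν s) ∧
    ∀ i : Fin ν,
      Lsub g α β ν i ⊓ (⨆ j : Fin ν, ⨆ _ : j ≠ i, Lsub g α β ν j) = ⊥ := by
  obtain ⟨A, B, hA, hBg, hlow⟩ := hframe.exists_bounds hα hβ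
  have hBγ := hγ.exists_isBessel hα hβ hA hBg hlow
  have hinj : Function.Injective fun p : ℤ × ℤ => (p.1, p.2 * (ν : ℤ)) := by
    have hν' : ν ≠ 0 := Nat.one_le_iff_ne_zero.mp hν
    rintro ⟨k, l⟩ ⟨k', l'⟩ h
    simpa [hν'] using h
  obtain ⟨P, hPsum⟩ := ((hBg.adjoint_lattice hα hβ).comp_injective hinj).exists_mixed_frame_operator
    ((hBγ.adjoint_lattice hα hβ).comp_injective hinj)
  have hgab (u : L2) : gabor β⁻¹ α⁻¹ u ∘ (fun p : ℤ × ℤ => (p.1, p.2 * (ν : ℤ)))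
      = gabor β⁻¹ (ν / α) u := by
    funext p
    simp only [Function.comp, gabor]
    congr 2
    push_cast
    ring
  simp only [hgab] at hPsum
  have htf (u : L2) (p : ℤ × ℤ) :
      tf ((p.1 : ℝ) / β, (p.2 : ℝ) * (ν : ℝ) / α) u = gabor β⁻¹ (ν / α) u p := by
    rw [gabor]; congr 2 <;> ring
  simp only [htf, mul_smul] at hP
  set κ : ℂ := (((α * β)⁻¹ : ℝ) : ℂ)
  have hwindow (s : ℕ) (hs : s < ν) : (κ • P) (Mo ((s : ℝ) / α) g) = if s = 0 then g else 0 :=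
    ((hPsum _).const_smul κ).unique (hP s hs)
  have hcomm (f : L2) (q : ℤ × ℤ) :
      (κ • P) (gabor β⁻¹ (ν / α) f q) = gabor β⁻¹ (ν / α) ((κ • P) f) q := by
    have h := (hPsum _).unique ((hPsum f).gabor_shift q)
    rw [smul_apply, h, smul_apply, gabor, gabor, tf_smul]
  refine directSum_of_projection hν (κ • P) fun k n => ?_
  have hν' : (0 : ℤ) < ν := by exact_mod_cast hν
  obtain ⟨s, hs⟩ := Int.eq_ofNat_of_zero_le (Int.emod_nonneg n hν'.ne')
  have hsν : s < ν := by
    have := Int.emod_lt_of_pos n hν'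
    lia
  have hn : n = n / ν * ν + s := by rw [← hs]; exact (Int.ediv_mul_add_emod n ν).symm
  have hgen : tf ((k : ℝ) / β, (n : ℝ) / α) g
      = gabor β⁻¹ (ν / α) (Mo ((s : ℝ) / α) g) (k, n / ν) := by
    rw [gabor, Mo_eq_tf, tf_tf, mul_zero, expTwoPi_zero, one_smul]
    congr 1
    have hn' : (n : ℝ) = ((n / ν : ℤ) : ℝ) * ν + s := by exact_mod_cast hn
    ext
    · simp; ring
    · simp only [Prod.snd_add]; rw [hn']; ring
  rw [hgen, hcomm, hwindow s hsν]
  by_cases h0 : s = 0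
  · have hdvd : (ν : ℤ) ∣ n := Int.dvd_of_emod_eq_zero (by rw [hs, h0]; rfl)
    rw [if_pos h0, if_pos hdvd, h0]
    rw [Mo_eq_tf]
    simp [← Prod.zero_eq_mk, tf_zero_left]
  · have hdvd : ¬ (ν : ℤ) ∣ n := fun h => h0 (by
      have := Int.emod_eq_zero_of_dvd h
      lia)
    rw [if_neg h0, if_neg hdvd, gabor, tf_zero_right]

end
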